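/- arXiv:0809.3372 — 6 statements merged into one kernel-verified Lean document; each statement's English description precedes it below -/
import Mathlib

section
/- Let G be a finite group, p a prime, S a Sylow p-subgroup of G, and A a subgroup of S that is strongly closed in S with respect to G. Let N be a normal subgroup of G and π : G → G/N the quotient homomorphism. Then π(S) is a Sylow p-subgroup of G/N and π(A) is strongly closed in π(S) with respect to G/N. -/
/-- `A` is strongly closed in `S` with respect to the ambient group `G`:
every `G`-conjugate of an element of `A` that lies in `S` already lies in `A`. -/
def IsStronglyClosed {G : Type*} [Group G] (A S : Subgroup G) : Prop :=
  ∀ a ∈ A, ∀ g : G, g * a * g⁻¹ ∈ S → g * a * g⁻¹ ∈ A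

/-- `P` is a Sylow `p`-subgroup of `G`: it is a `p`-group whose index is coprime to `p`. -/
def IsSylowSubgroup (p : ℕ) {G : Type*} [Group G] (P : Subgroup G) : Prop :=
  IsPGroup p P ∧ Nat.Coprime P.index p

/-- A `p`-subgroup of `S ⊔ N`, with `S` Sylow and `N` normal, is conjugate into `S` by an
element of `N`. -/
theorem Sylow.exists_conj_mem_of_le_sup {G : Type*} [Group G] [Finite G] {p : ℕ} [Fact p.Prime]
    (S : Sylow p G) (N : Subgroup G) [N.Normal] {Q : Subgroup G} (hQ : IsPGroup p Q)
    (hQSN : Q ≤ (S : Subgroup G) ⊔ N) :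
    ∃ n ∈ N, ∀ x ∈ Q, n * x * n⁻¹ ∈ S := by
  let H : Subgroup G := (S : Subgroup G) ⊔ N
  have hSH : (S : Subgroup G) ≤ H := le_sup_left
  obtain ⟨R, hR⟩ :=
    (hQ.comap_of_injective H.subtype H.subtype_injective).exists_le_sylow
  obtain ⟨h, hh⟩ := MulAction.exists_smul_eq H R (S.subtype hSH)
  obtain ⟨s, hs, n, hn, hsn⟩ := Subgroup.mem_sup_of_normal_right.mp h.2
  refine ⟨n, hn, fun x hx => ?_⟩
  have hxS : MulAut.conj h ⟨x, hQSN hx⟩ ∈ S.subtype hSH := by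
    rw [← hh]
    exact Subgroup.smul_mem_pointwise_smul _ _ _ (hR hx)
  have hconj : (s * n) * x * (s * n)⁻¹ ∈ S := by
    rw [hsn]
    exact hxS
  have : s⁻¹ * (s * n * x * (s * n)⁻¹) * s ∈ S := S.mul_mem (S.mul_mem (S.inv_mem hs) hconj) hs
  simpa [mul_assoc] using this

/-- Strong closure passes to quotient groups: if `A` is strongly closed in the Sylow
`p`-subgroup `S` of the finite group `G` and `N ⊴ G`, then the image of `S` in `G ⧸ N`
is a Sylow `p`-subgroup and the image of `A` is strongly closed in it. -/
theorem stronglyClosed_map_quotient (G : Type*) [Group G] [Finite G]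
    (p : ℕ) [Fact p.Prime] (S : Sylow p G) (A : Subgroup G) (hAS : A ≤ S)
    (hsc : IsStronglyClosed A S) (N : Subgroup G) [N.Normal] :
    IsSylowSubgroup p ((S : Subgroup G).map (QuotientGroup.mk' N)) ∧
      IsStronglyClosed (A.map (QuotientGroup.mk' N))
        ((S : Subgroup G).map (QuotientGroup.mk' N)) := by
  have hsurj := QuotientGroup.mk'_surjective N
  refine ⟨⟨(S.mapSurjective hsurj).isPGroup', ?_⟩, ?_⟩
  · exact ((Fact.out : p.Prime).coprime_iff_not_dvd.mpr (S.mapSurjective hsurj).not_dvd_index).symm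
  · rintro _ ⟨a, ha, rfl⟩ g' hg'
    obtain ⟨g, rfl⟩ := hsurj g'
    rw [← map_inv, ← map_mul, ← map_mul] at hg' ⊢
    have hmem : g * a * g⁻¹ ∈ (S : Subgroup G) ⊔ N := by
      rwa [← Subgroup.mem_comap, Subgroup.comap_map_eq, QuotientGroup.ker_mk'] at hg'
    have hgS : g * a * g⁻¹ ∈ (g • S : Sylow p G) :=
      Subgroup.smul_mem_pointwise_smul a (MulAut.conj g) _ (hAS ha)
    obtain ⟨n, hn, hconj⟩ := S.exists_conj_mem_of_le_sup N
      ((g • S : Sylow p G).isPGroup'.to_le (Subgroup.zpowers_le.mpr hgS))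
      (Subgroup.zpowers_le.mpr hmem)
    have hS := hconj _ (Subgroup.mem_zpowers _)
    have heq : n * (g * a * g⁻¹) * n⁻¹ = (n * g) * a * (n * g)⁻¹ := by group
    refine ⟨_, hsc a ha (n * g) (heq ▸ hS), ?_⟩
    have hn1 : QuotientGroup.mk' N n = 1 := (QuotientGroup.eq_one_iff n).mpr hn
    simp only [map_mul, map_inv, hn1, one_mul]
end

section
/- Let p be a prime and R a finite group whose order is divisible by p, and let X be a subgroup of R of order p. Then there exist a finite group G and a surjective group homomorphism π : G → R whose kernel E is a nontrivial elementary abelian p-group (abelian with x^p = 1 for all x ∈ E), such that: (i) the preimage π⁻¹(X) has no complement to E, i.e., there is no subgroup K of G with K ∩ E = 1 and K·E = π⁻¹(X); indeed every element of π⁻¹(X) not lying in E has order p²; and (ii) for every subgroup Z of R of order p that is not conjugate in R to X, the preimage π⁻¹(Z) splits over E, i.e., there exists a subgroup K of G with K ∩ E = 1 and K·E = π⁻¹(Z). -/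
/-- A function `j` on a group that is invariant under left multiplication by `Z` and grows by `1`
under right multiplication by `x`, provided the powers of `x` act freely modulo `p` on the right
cosets of `Z`. -/
theorem exists_leftInvariant_rightEquivariant {R : Type*} [Group R] (p : ℕ) (Z : Subgroup R)
    (x : R) (hfree : ∀ z ∈ Z, ∀ (s : R) (i : ℤ), z * s * x ^ i = s → (p : ℤ) ∣ i) :
    ∃ j : R → ZMod p, (∀ z ∈ Z, ∀ s, j (z * s) = j s) ∧ ∀ s, j (s * x) = j s + 1 := by
  let S : Setoid R :=
    { r := fun s t => ∃ z ∈ Z, ∃ i : ℤ, z * s * x ^ i = t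
      iseqv :=
        { refl := fun s => ⟨1, Z.one_mem, 0, by simp⟩
          symm := by
            rintro s _ ⟨z, hz, i, rfl⟩
            exact ⟨z⁻¹, Z.inv_mem hz, -i, by group⟩
          trans := by
            rintro s _ _ ⟨z, hz, i, rfl⟩ ⟨w, hw, l, rfl⟩
            exact ⟨w * z, Z.mul_mem hw hz, i + l, by group⟩ } }
  have hrep : ∀ s : R, ∃ z ∈ Z, ∃ i : ℤ, z * (Quotient.mk S s).out * x ^ i = s :=
    fun s => Quotient.mk_out (s := S) s
  choose a ha i hi using hrep
  have key : ∀ (s t : R) (z : R) (_ : z ∈ Z) (l : ℤ), z * s * x ^ l = t →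
      (i t : ZMod p) = (i s : ZMod p) + (l : ZMod p) := by
    intro s t z hz l hst
    have hq : Quotient.mk S s = Quotient.mk S t := Quotient.sound ⟨z, hz, l, hst⟩
    have hs := hi s
    have ht := hi t
    rw [← hq] at ht
    set o := (Quotient.mk S s).out
    have hdvd : (p : ℤ) ∣ (i s + l - i t) := by
      refine hfree ((a t)⁻¹ * (z * a s)) (Z.mul_mem (Z.inv_mem (ha t)) (Z.mul_mem hz (ha s))) o _ ?_
      have h : z * (a s * o * x ^ i s) * x ^ l = a t * o * x ^ i t := by rw [hs, hst, ht]
      calc (a t)⁻¹ * (z * a s) * o * x ^ (i s + l - i t)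
          = (a t)⁻¹ * (z * (a s * o * x ^ i s) * x ^ l) * (x ^ i t)⁻¹ := by
            rw [zpow_sub, zpow_add]; simp only [mul_assoc]
        _ = o := by rw [h]; group
    have h0 := (ZMod.intCast_zmod_eq_zero_iff_dvd _ p).2 hdvd
    push_cast at h0
    exact (sub_eq_zero.1 h0).symm
  refine ⟨fun s => (i s : ZMod p), fun z hz s => ?_, fun s => ?_⟩
  · simpa using key s (z * s) z hz 0 (by simp)
  · simpa using key s (s * x) 1 Z.one_mem 1 (by simp)

/-- Reduction from `ZMod (p ^ 2)` to `ZMod p`. -/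
def ZMod.reduceSq (p : ℕ) : ZMod (p ^ 2) →+* ZMod p :=
  ZMod.castHom (dvd_pow_self p two_ne_zero) (ZMod p)

theorem ZMod.reduceSq_surjective (p : ℕ) : Function.Surjective (ZMod.reduceSq p) :=
  ZMod.castHom_surjective _

theorem ZMod.natCast_mul_eq_zero_iff_reduceSq {p : ℕ} (hp : p ≠ 0) (a : ZMod (p ^ 2)) :
    (p : ZMod (p ^ 2)) * a = 0 ↔ ZMod.reduceSq p a = 0 := by
  obtain ⟨n, rfl⟩ := ZMod.intCast_surjective a
  rw [map_intCast, ZMod.intCast_zmod_eq_zero_iff_dvd]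
  have h : (p : ZMod (p ^ 2)) * (n : ZMod (p ^ 2)) = ((p * n : ℤ) : ZMod (p ^ 2)) := by
    push_cast; rfl
  rw [h, ZMod.intCast_zmod_eq_zero_iff_dvd, Nat.cast_pow, pow_two]
  exact mul_dvd_mul_iff_left (by exact_mod_cast hp)

/-- Pairs of an element `base` of `R` and a function `twist` with values in `ZMod (p ^ 2)`,
constant on left cosets of `⟨x⟩`, that lifts `s ↦ k (base * s) - k s`. This is the preimage
of `R` in the wreath product of the cyclic group of order `p ^ 2` with the permutations of the
cosets of `⟨x⟩`. -/
@[ext]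
structure CosetTwist {R : Type*} [Group R] (p : ℕ) (x : R) (k : R → ZMod p) where
  /-- The image in `R`. -/
  base : R
  /-- The component in the base group of the wreath product. -/
  twist : R → ZMod (p ^ 2)
  twist_mul_right : ∀ s, twist (s * x) = twist s
  reduce_twist : ∀ s, ZMod.reduceSq p (twist s) = k (base * s) - k s

namespace CosetTwist

variable {R : Type*} [Group R] {p : ℕ} {x : R} {k : R → ZMod p}

instance : Mul (CosetTwist p x k) where
  mul g h :=
    { base := g.base * h.base
      twist := fun s => g.twist (h.base * s) + h.twist s
      twist_mul_right := fun s => by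
        rw [← mul_assoc, g.twist_mul_right, h.twist_mul_right]
      reduce_twist := fun s => by
        rw [map_add, g.reduce_twist, h.reduce_twist, mul_assoc]; ring }

instance : One (CosetTwist p x k) where
  one :=
    { base := 1
      twist := fun _ => 0
      twist_mul_right := fun _ => rfl
      reduce_twist := fun s => by simp }

instance : Inv (CosetTwist p x k) where
  inv g :=
    { base := g.base⁻¹
      twist := fun s => -g.twist (g.base⁻¹ * s)
      twist_mul_right := fun s => by rw [← mul_assoc, g.twist_mul_right]
      reduce_twist := fun s => by
        rw [map_neg, g.reduce_twist, mul_inv_cancel_left]; ring }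

@[simp] theorem base_mul (g h : CosetTwist p x k) : (g * h).base = g.base * h.base := rfl

@[simp] theorem twist_mul (g h : CosetTwist p x k) (s : R) :
    (g * h).twist s = g.twist (h.base * s) + h.twist s := rfl

@[simp] theorem base_one : (1 : CosetTwist p x k).base = 1 := rfl

@[simp] theorem twist_one (s : R) : (1 : CosetTwist p x k).twist s = 0 := rfl

@[simp] theorem base_inv (g : CosetTwist p x k) : g⁻¹.base = g.base⁻¹ := rfl

@[simp] theorem twist_inv (g : CosetTwist p x k) (s : R) :
    g⁻¹.twist s = -g.twist (g.base⁻¹ * s) := rfl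

instance : Group (CosetTwist p x k) :=
  Group.ofLeftAxioms
    (fun f g h => by
      ext s
      · simp [mul_assoc]
      · simp [mul_assoc, add_assoc])
    (fun g => by ext s <;> simp)
    (fun g => by ext s <;> simp)

theorem finite [Finite R] (hp : p ≠ 0) : Finite (CosetTwist p x k) := by
  have : NeZero (p ^ 2) := ⟨pow_ne_zero 2 hp⟩
  refine Finite.of_injective
    (fun g : CosetTwist p x k => ((g.base, g.twist) : R × (R → ZMod (p ^ 2)))) ?_
  intro g h hgh
  simp only [Prod.mk.injEq] at hgh
  exact CosetTwist.ext hgh.1 hgh.2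

variable (p x k) in
/-- The projection to `R`. -/
def proj : CosetTwist p x k →* R where
  toFun := base
  map_one' := rfl
  map_mul' _ _ := rfl

theorem proj_apply (g : CosetTwist p x k) : proj p x k g = g.base := rfl

theorem mem_ker_proj {g : CosetTwist p x k} : g ∈ (proj p x k).ker ↔ g.base = 1 := Iff.rfl

theorem base_pow (g : CosetTwist p x k) (n : ℕ) : (g ^ n).base = g.base ^ n :=
  map_pow (proj p x k) g n

theorem proj_surjective (hk : ∀ s, k (s * x) = k s + 1) :
    Function.Surjective (proj p x k) := by
  intro r
  have hL := Function.surjInv_eq (ZMod.reduceSq_surjective p)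
  exact ⟨⟨r, fun s => Function.surjInv (ZMod.reduceSq_surjective p) (k (r * s) - k s),
    fun s => by rw [← mul_assoc, hk, hk, add_sub_add_right_eq_sub], fun s => hL _⟩, rfl⟩

theorem twist_pow_of_fixed (g : CosetTwist p x k) (s : R)
    (h : ∀ n : ℕ, g.twist (g.base ^ n * s) = g.twist s) (n : ℕ) :
    (g ^ n).twist s = n * g.twist s := by
  induction n with
  | zero => simp
  | succ n ih =>
    rw [pow_succ' g, twist_mul, base_pow, h, ih]
    push_cast
    ring

theorem twist_zpow (g : CosetTwist p x k) (i : ℤ) : g.twist (x ^ i) = g.twist 1 := by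
  induction i with
  | zero => simp
  | succ i ih => rw [zpow_add_one, g.twist_mul_right, ih]
  | pred i ih => rw [← ih, ← g.twist_mul_right (x ^ (-(i : ℤ) - 1)), ← zpow_add_one]; simp

theorem apply_zpow (hk : ∀ s, k (s * x) = k s + 1) (i : ℤ) : k (x ^ i) = k 1 + i := by
  induction i with
  | zero => simp
  | succ i ih => rw [zpow_add_one, hk, ih]; push_cast; ring
  | pred i ih =>
    have h := hk (x ^ (-(i : ℤ) - 1))
    rw [← zpow_add_one, sub_add_cancel, ih] at h
    push_cast at h ⊢
    linear_combination -h

theorem ker_mul_comm {g h : CosetTwist p x k} (hg : g ∈ (proj p x k).ker)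
    (hh : h ∈ (proj p x k).ker) : g * h = h * g := by
  rw [mem_ker_proj] at hg hh
  ext s
  · simp [hg, hh]
  · simp [hg, hh, add_comm]

theorem ker_pow (hp : p ≠ 0) {g : CosetTwist p x k} (hg : g ∈ (proj p x k).ker) :
    g ^ p = 1 := by
  rw [mem_ker_proj] at hg
  ext s
  · rw [base_pow, hg, one_pow, base_one]
  · rw [twist_pow_of_fixed g s (by simp [hg]), twist_one,
      ZMod.natCast_mul_eq_zero_iff_reduceSq hp, g.reduce_twist, hg, one_mul, sub_self]

theorem orderOf_of_base_mem_zpowers (hp : p.Prime) (hx : x ^ p = 1)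
    (hk : ∀ s, k (s * x) = k s + 1) {g : CosetTwist p x k}
    (hgx : g.base ∈ Subgroup.zpowers x) (hg : g ∉ (proj p x k).ker) : orderOf g = p ^ 2 := by
  obtain ⟨i, hi⟩ := Subgroup.mem_zpowers_iff.1 hgx
  have : Fact p.Prime := ⟨hp⟩
  have hbase : (g ^ p).base = 1 := by
    rw [base_pow, ← hi, ← zpow_natCast, zpow_comm, zpow_natCast, hx, one_zpow]
  refine orderOf_eq_prime_pow (n := 1) ?_ ?_
  · rw [pow_one]
    intro h
    have htw := congrArg (fun f => f.twist 1) h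
    simp only [twist_one] at htw
    rw [twist_pow_of_fixed g 1 (fun n => by
      rw [mul_one, ← hi, ← zpow_natCast, ← zpow_mul, twist_zpow]),
      ZMod.natCast_mul_eq_zero_iff_reduceSq hp.ne_zero, g.reduce_twist, mul_one, ← hi,
      apply_zpow hk, add_sub_cancel_left, ZMod.intCast_zmod_eq_zero_iff_dvd] at htw
    obtain ⟨m, rfl⟩ := htw
    apply hg
    rw [mem_ker_proj, ← hi, zpow_mul, zpow_natCast, hx, one_zpow]
  · rw [one_add_one_eq_two, pow_two, pow_mul]
    exact ker_pow hp.ne_zero hbase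

/-- An element `z` of order dividing `p` lifts to an element of order dividing `p`, as soon as its
powers act freely on the cosets of `⟨x⟩`. -/
theorem exists_lift_pow_eq_one (hk : ∀ s, k (s * x) = k s + 1) {z : R} (hz : z ^ p = 1)
    {j : R → ZMod p} (hj : ∀ s, j (z * s) = j s) (hjx : ∀ s, j (s * x) = j s + 1) :
    ∃ g : CosetTwist p x k, g.base = z ∧ g ^ p = 1 := by
  let L := Function.surjInv (ZMod.reduceSq_surjective p)
  have hL : ∀ a, ZMod.reduceSq p (L a) = a := Function.surjInv_eq (ZMod.reduceSq_surjective p)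
  let q : R → ZMod p := fun s => k s - j s
  have hq : ∀ s, q (s * x) = q s := fun s => by
    simp only [q, hk, hjx, add_sub_add_right_eq_sub]
  let g : CosetTwist p x k :=
    { base := z
      twist := fun s => L (q (z * s)) - L (q s)
      twist_mul_right := fun s => by rw [← mul_assoc, hq, hq]
      reduce_twist := fun s => by
        rw [map_sub, hL, hL]
        simp only [q, hj]
        ring }
  have hpow : ∀ (n : ℕ) (s : R), (g ^ n).twist s = L (q (z ^ n * s)) - L (q s) := by
    intro n s
    induction n with
    | zero => simp
    | succ n ih =>
      rw [pow_succ' g, twist_mul, base_pow, ih]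
      change L (q (z * (z ^ n * s))) - L (q (z ^ n * s)) + _ = _
      rw [pow_succ' z, mul_assoc]
      ring
  refine ⟨g, rfl, ?_⟩
  ext s
  · rw [base_pow, base_one]
    exact hz
  · rw [hpow, hz, one_mul, sub_self, twist_one]

end CosetTwist

theorem Subgroup.eq_zpowers_of_prime_card {R : Type*} [Group R] {p : ℕ} (hp : p.Prime)
    {H : Subgroup R} (hH : Nat.card H = p) {a : R} (ha : a ∈ H) (ha1 : a ≠ 1) :
    H = Subgroup.zpowers a := by
  have : Finite H := Nat.finite_of_card_ne_zero (hH ▸ hp.ne_zero)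
  have hle : Subgroup.zpowers a ≤ H := (Subgroup.zpowers_le).2 ha
  refine (Subgroup.eq_of_le_of_card_ge hle ?_).symm
  rw [hH, Nat.card_zpowers]
  have hdvd : orderOf a ∣ p := by
    rw [← hH, ← Nat.card_zpowers]
    exact Subgroup.card_dvd_of_le hle
  rcases (Nat.dvd_prime hp).1 hdvd with h | h
  · exact absurd (orderOf_eq_one_iff.1 h) ha1
  · exact h.ge

theorem Subgroup.exists_orderOf_of_prime_card {R : Type*} [Group R] {p : ℕ} (hp : p.Prime)
    {H : Subgroup R} (hH : Nat.card H = p) :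
    ∃ a : R, orderOf a = p ∧ H = Subgroup.zpowers a := by
  have hne : H ≠ ⊥ := by
    rintro rfl
    rw [Subgroup.card_bot] at hH
    exact hp.ne_one hH.symm
  obtain ⟨a, ha, ha1⟩ := H.bot_or_exists_ne_one.resolve_left hne
  have h := Subgroup.eq_zpowers_of_prime_card hp hH ha ha1
  exact ⟨a, by rw [← Nat.card_zpowers, ← h, hH], h⟩

/-- If `π g` has order `p` and `g ^ p = 1` then `⟨g⟩` is a complement of the kernel in the
preimage of `⟨π g⟩`. -/
theorem MonoidHom.exists_complement_ker_comap_zpowers {G R : Type*} [Group G] [Group R]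
    (π : G →* R) {g : G} {p : ℕ} (hπ : orderOf (π g) = p) (hg : g ^ p = 1) :
    ∃ K : Subgroup G, K ⊓ π.ker = ⊥ ∧ K ⊔ π.ker = (Subgroup.zpowers (π g)).comap π := by
  refine ⟨Subgroup.zpowers g, ?_, ?_⟩
  · rw [eq_bot_iff]
    rintro y ⟨hy, hyker⟩
    obtain ⟨i, rfl⟩ := Subgroup.mem_zpowers_iff.1 hy
    have h1 : π g ^ i = 1 := by rw [← map_zpow]; exact hyker
    obtain ⟨m, rfl⟩ := orderOf_dvd_iff_zpow_eq_one.2 h1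
    rw [Subgroup.mem_bot, hπ, zpow_mul, zpow_natCast, hg, one_zpow]
  · rw [← Subgroup.comap_map_eq, MonoidHom.map_zpowers]

/-- If all elements of `π⁻¹(X)` outside the kernel have order `p ^ 2`, the kernel has no complement
in `π⁻¹(X)`. -/
theorem MonoidHom.not_exists_complement_of_orderOf {G R : Type*} [Group G] [Group R]
    {p : ℕ} (hp : p.Prime) (π : G →* R) (hπ : Function.Surjective π) {X : Subgroup R}
    (hX : Nat.card X = p) (hord : ∀ g ∈ X.comap π, g ∉ π.ker → orderOf g = p ^ 2) :
    ¬ ∃ K : Subgroup G, K ⊓ π.ker = ⊥ ∧ K ⊔ π.ker = X.comap π := by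
  rintro ⟨K, hbot, hsup⟩
  obtain ⟨x, hx, rfl⟩ := Subgroup.exists_orderOf_of_prime_card hp hX
  obtain ⟨y, rfl⟩ := hπ x
  have hy : y ∈ K ⊔ π.ker := by
    rw [hsup]
    exact Subgroup.mem_zpowers (π y)
  obtain ⟨g, hg, e, he, rfl⟩ := Subgroup.mem_sup_of_normal_right.1 hy
  rw [map_mul, MonoidHom.mem_ker.1 he, mul_one] at hx hord
  have hgker : g ∉ π.ker := by
    intro h
    rw [MonoidHom.mem_ker.1 h, orderOf_one] at hx
    exact hp.ne_one hx.symm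
  have hgp : g ^ p = 1 := by
    rw [← Subgroup.mem_bot, ← hbot]
    refine Subgroup.mem_inf.2 ⟨K.pow_mem hg p, ?_⟩
    rw [MonoidHom.mem_ker, map_pow, ← hx, pow_orderOf_eq_one]
  have h2 := hord g (Subgroup.mem_zpowers (π g)) hgker
  have h3 := h2 ▸ orderOf_dvd_of_pow_eq_one hgp
  have h4 := Nat.le_of_dvd hp.pos h3
  nlinarith [hp.two_le]

/-- The powers of `x` act freely on the right cosets of `Z` when `Z` and `⟨x⟩` are subgroups of order
`p` that are not conjugate. -/
theorem dvd_of_mul_mul_zpow_eq_of_not_conj {R : Type*} [Group R] {p : ℕ} (hp : p.Prime) {x : R}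
    (hx : orderOf x = p) {Z : Subgroup R} (hZ : Nat.card Z = p)
    (hconj : ¬ ∃ r : R, (Subgroup.zpowers x).map (MulAut.conj r).toMonoidHom = Z)
    {z : R} (hz : z ∈ Z) (s : R) (i : ℤ) (h : z * s * x ^ i = s) : (p : ℤ) ∣ i := by
  by_contra hi
  have hxi : x ^ i ≠ 1 := fun h1 => hi (hx ▸ orderOf_dvd_iff_zpow_eq_one.2 h1)
  have hzeq : z⁻¹ = s * x ^ i * s⁻¹ := by
    rw [inv_eq_iff_mul_eq_one, ← mul_assoc, ← mul_assoc, h, mul_inv_cancel]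
  have hz1 : z⁻¹ ≠ 1 := by
    rw [hzeq, Ne, conj_eq_one_iff]
    exact hxi
  refine hconj ⟨s, ?_⟩
  rw [Subgroup.eq_zpowers_of_prime_card hp hZ (Z.inv_mem hz) hz1]
  refine Subgroup.eq_zpowers_of_prime_card hp ?_ ?_ hz1
  · rw [Subgroup.card_map_of_injective (MulAut.conj s).injective, Nat.card_zpowers, hx]
  · exact ⟨x ^ i, Subgroup.zpow_mem_zpowers x i, by simp [hzeq]⟩

/-- `π` is an extension of `R` by an elementary abelian `p`-group in which the elements over `X`
outside the kernel have order `p ^ 2`, while the subgroups of order `p` not conjugate to `X`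
lift isomorphically. -/
structure MonoidHom.IsHalfSplit {G R : Type*} [Group G] [Group R] (p : ℕ) (X : Subgroup R)
    (π : G →* R) : Prop where
  surjective : Function.Surjective π
  mul_comm : ∀ x ∈ π.ker, ∀ y ∈ π.ker, x * y = y * x
  pow_eq_one : ∀ x ∈ π.ker, x ^ p = 1
  orderOf_eq : ∀ g ∈ X.comap π, g ∉ π.ker → orderOf g = p ^ 2
  exists_complement : ∀ Z : Subgroup R, Nat.card Z = p →
    (¬ ∃ r : R, X.map (MulAut.conj r).toMonoidHom = Z) →
    ∃ K : Subgroup G, K ⊓ π.ker = ⊥ ∧ K ⊔ π.ker = Z.comap π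

theorem MonoidHom.IsHalfSplit.ker_ne_bot {G R : Type*} [Group G] [Group R] {p : ℕ}
    {X : Subgroup R} {π : G →* R} (h : π.IsHalfSplit p X) (hp : p.Prime) (hX : Nat.card X = p) :
    π.ker ≠ ⊥ := fun hker =>
  MonoidHom.not_exists_complement_of_orderOf hp π h.surjective hX h.orderOf_eq
    ⟨X.comap π, by rw [hker, inf_bot_eq], by rw [hker, sup_bot_eq]⟩

theorem MonoidHom.IsHalfSplit.mulEquiv_comp {G Q R : Type*} [Group G] [Group Q] [Group R]
    {p : ℕ} {X : Subgroup R} (e : Q ≃* R) {π : G →* Q}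
    (h : π.IsHalfSplit p (X.comap e.toMonoidHom)) : (e.toMonoidHom.comp π).IsHalfSplit p X := by
  have hker : (e.toMonoidHom.comp π).ker = π.ker := by
    ext g
    simp [MonoidHom.mem_ker]
  refine ⟨e.surjective.comp h.surjective, ?_, ?_, ?_, ?_⟩
  · rw [hker]; exact h.mul_comm
  · rw [hker]; exact h.pow_eq_one
  · rw [hker]; exact h.orderOf_eq
  · intro Z hZ hconj
    rw [hker]
    refine h.exists_complement (Z.comap e.toMonoidHom) ?_ ?_
    · rw [← hZ]
      exact Nat.card_congr (e.toEquiv.subtypeEquiv fun _ => Iff.rfl)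
    · rintro ⟨r, hr⟩
      refine hconj ⟨e r, ?_⟩
      have hXe : X = (X.comap e.toMonoidHom).map e.toMonoidHom :=
        (Subgroup.map_comap_eq_self_of_surjective e.surjective X).symm
      rw [← Subgroup.map_comap_eq_self_of_surjective (f := e.toMonoidHom) e.surjective Z, ← hr]
      conv_lhs => rw [hXe]
      rw [Subgroup.map_map, Subgroup.map_map]
      congr 1
      ext y
      simp

theorem exists_isHalfSplit {p : ℕ} (hp : p.Prime) {R : Type*} [Group R]
    {X : Subgroup R} (hX : Nat.card X = p) :
    ∃ (x : R) (k : R → ZMod p), (CosetTwist.proj p x k).IsHalfSplit p X := by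
  obtain ⟨x, hx, rfl⟩ := Subgroup.exists_orderOf_of_prime_card hp hX
  obtain ⟨k, -, hk⟩ := exists_leftInvariant_rightEquivariant p ⊥ x (by
    intro z hz s i h
    rw [Subgroup.mem_bot.1 hz, one_mul, mul_eq_left] at h
    exact hx ▸ orderOf_dvd_iff_zpow_eq_one.2 h)
  refine ⟨x, k, CosetTwist.proj_surjective hk, fun _ hg _ hh => CosetTwist.ker_mul_comm hg hh,
    fun _ hg => CosetTwist.ker_pow hp.ne_zero hg, fun g hgx hg =>
    CosetTwist.orderOf_of_base_mem_zpowers hp (hx ▸ pow_orderOf_eq_one x) hk hgx hg, ?_⟩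
  intro Z hZ hconj
  obtain ⟨j, hj, hjx⟩ := exists_leftInvariant_rightEquivariant p Z x fun z hz s i h =>
    dvd_of_mul_mul_zpow_eq_of_not_conj hp hx hZ hconj hz s i h
  obtain ⟨z, hz, rfl⟩ := Subgroup.exists_orderOf_of_prime_card hp hZ
  obtain ⟨g, rfl, hg⟩ := CosetTwist.exists_lift_pow_eq_one hk (hz ▸ pow_orderOf_eq_one z)
    (hj z (Subgroup.mem_zpowers z)) hjx
  exact MonoidHom.exists_complement_ker_comap_zpowers (CosetTwist.proj p x k) hz hg

/-- Half-split extensions: given a finite group `R` of order divisible by `p` and a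
subgroup `X` of order `p`, there is an extension `G` of `R` by a nontrivial elementary
abelian `p`-group `E = ker π` such that the preimage of `X` does not split over `E`
(indeed every element of `π⁻¹(X) \ E` has order `p²`), but the preimage of every
subgroup `Z` of order `p` not conjugate to `X` does split over `E`. -/
theorem halfsplit_extension_exists
    (p : ℕ) (hp : p.Prime) (R : Type*) [Group R] [Finite R]
    (hdvd : p ∣ Nat.card R) (X : Subgroup R) (hX : Nat.card X = p) :
    ∃ (G : Type) (_ : Group G) (_ : Finite G) (π : G →* R),
      Function.Surjective π ∧
      π.ker ≠ ⊥ ∧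
      (∀ x ∈ π.ker, ∀ y ∈ π.ker, x * y = y * x) ∧
      (∀ x ∈ π.ker, x ^ p = 1) ∧
      (¬ ∃ K : Subgroup G, K ⊓ π.ker = ⊥ ∧ K ⊔ π.ker = X.comap π) ∧
      (∀ g ∈ X.comap π, g ∉ π.ker → orderOf g = p ^ 2) ∧
      (∀ Z : Subgroup R, Nat.card Z = p →
        (¬ ∃ r : R, X.map (MulAut.conj r).toMonoidHom = Z) →
        ∃ K : Subgroup G, K ⊓ π.ker = ⊥ ∧ K ⊔ π.ker = Z.comap π) := by
  let e : Shrink.{0} R ≃* R := Shrink.mulEquiv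
  have : Finite (Shrink.{0} R) := Finite.of_equiv R e.symm.toEquiv
  have hXe : Nat.card (X.comap e.toMonoidHom) = p := by
    rw [← hX]
    exact Nat.card_congr (e.toEquiv.subtypeEquiv fun _ => Iff.rfl)
  obtain ⟨x, k, h⟩ := exists_isHalfSplit hp hXe
  have hs := MonoidHom.IsHalfSplit.mulEquiv_comp e h
  exact ⟨CosetTwist p x k, inferInstance, CosetTwist.finite hp.ne_zero, _, hs.surjective,
    hs.ker_ne_bot hp hX, hs.mul_comm, hs.pow_eq_one,
    MonoidHom.not_exists_complement_of_orderOf hp _ hs.surjective hX hs.orderOf_eq,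
    hs.orderOf_eq, hs.exists_complement⟩
end

section
/- Let p be an odd prime and let n ≥ 5. Let S be a Sylow p-subgroup of the alternating group Alt(n) and let A be a nontrivial subgroup of S that is strongly closed in S with respect to Alt(n). Then A = S; that is, every nontrivial strongly closed p-subgroup of Alt(n) is a Sylow p-subgroup of Alt(n). -/
/-- Translation of each fibre of `α × ZMod p` by its own amount. -/
def fibrewiseShift (α : Type*) (p : ℕ) :
    (α → Multiplicative (ZMod p)) →* Equiv.Perm (α × ZMod p) where
  toFun u :=
    { toFun := fun x => (x.1, x.2 + (u x.1).toAdd)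
      invFun := fun x => (x.1, x.2 - (u x.1).toAdd)
      left_inv := fun x => by simp
      right_inv := fun x => by simp }
  map_one' := by ext x <;> simp
  map_mul' u v := by
    ext x
    · simp
    · simp [add_comm, add_left_comm]

/-- A permutation of `α` acting on the first coordinate of `α × β`. -/
def permFst (α β : Type*) : Equiv.Perm α →* Equiv.Perm (α × β) where
  toFun σ := Equiv.prodCongr σ (Equiv.refl β)
  map_one' := by ext x <;> simp
  map_mul' σ τ := by ext x <;> simp

theorem fibrewiseShift_apply {α : Type*} {p : ℕ} (u : α → Multiplicative (ZMod p))
    (x : α × ZMod p) : fibrewiseShift α p u x = (x.1, x.2 + (u x.1).toAdd) := rfl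

theorem permFst_apply {α β : Type*} (σ : Equiv.Perm α) (x : α × β) :
    permFst α β σ x = (σ x.1, x.2) := rfl

theorem fibrewiseShift_injective (α : Type*) (p : ℕ) :
    Function.Injective (fibrewiseShift α p) := by
  intro u v h
  funext i
  have := congrArg (fun f : Equiv.Perm (α × ZMod p) => (f (i, 0)).2) h
  simpa [fibrewiseShift_apply] using this

theorem permFst_injective (α β : Type*) [Nonempty β] : Function.Injective (permFst α β) := by
  intro σ τ h
  ext i
  have := congrArg (fun f : Equiv.Perm (α × β) => (f (i, Classical.arbitrary β)).1) h
  simpa [permFst_apply] using this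

theorem permFst_conj_fibrewiseShift {α : Type*} {p : ℕ} (σ : Equiv.Perm α)
    (u : α → Multiplicative (ZMod p)) :
    permFst α (ZMod p) σ * fibrewiseShift α p u * (permFst α (ZMod p) σ)⁻¹ =
      fibrewiseShift α p (u ∘ σ.symm) := by
  rw [mul_inv_eq_iff_eq_mul]
  ext x <;> simp [fibrewiseShift_apply, permFst_apply]

theorem disjoint_range_fibrewiseShift_permFst (α : Type*) (p : ℕ) :
    Disjoint (fibrewiseShift α p).range (permFst α (ZMod p)).range := by
  rw [Subgroup.disjoint_def]
  rintro _ ⟨u, rfl⟩ ⟨σ, h⟩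
  have hσ : σ = 1 := by
    ext i
    have := congrArg (fun f : Equiv.Perm (α × ZMod p) => (f (i, 0)).1) h
    simpa [permFst_apply, fibrewiseShift_apply] using this
  rw [← h, hσ, map_one]

/-- The symmetric group on `n` letters has a `p`-subgroup of order at least the `p`-part of `n!`
that is generated by its elements of exponent `p`. -/
theorem exists_isPGroup_perm_fin_le_closure (p : ℕ) [hp : Fact p.Prime] (n : ℕ) :
    ∃ P : Subgroup (Equiv.Perm (Fin n)), IsPGroup p P ∧
      p ^ padicValNat p n.factorial ≤ Nat.card P ∧
      P ≤ Subgroup.closure {x | x ∈ P ∧ x ^ p = 1} := by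
  induction n using Nat.strong_induction_on with
  | _ n ih =>
  rcases Nat.eq_zero_or_pos n with rfl | hn
  · exact ⟨⊥, IsPGroup.of_bot, by simp, bot_le⟩
  obtain ⟨Q, hQ, hcard, hgen⟩ := ih (n / p) (Nat.div_lt_self hn hp.out.one_lt)
  set E := (fibrewiseShift (Fin (n / p)) p).range
  set R := Q.map (permFst (Fin (n / p)) (ZMod p))
  have hE : IsPGroup p E := by
    refine IsPGroup.of_surjective (G := Fin (n / p) → Multiplicative (ZMod p))
      (IsPGroup.of_card (n := n / p) ?_) _ (fibrewiseShift (Fin (n / p)) p).rangeRestrict_surjective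
    simp [Nat.card_eq_fintype_card]
  have hcardE : Nat.card E = p ^ (n / p) := by
    rw [← Nat.card_congr (MonoidHom.ofInjective (fibrewiseShift_injective (Fin (n / p)) p)).toEquiv]
    simp [Nat.card_eq_fintype_card]
  have hR : IsPGroup p R := hQ.map _
  have hcardR : Nat.card R = Nat.card Q :=
    Subgroup.card_map_of_injective (permFst_injective (Fin (n / p)) (ZMod p))
  have hnorm : R ≤ Subgroup.normalizer (E : Set (Equiv.Perm (Fin (n / p) × ZMod p))) := by
    rw [Subgroup.le_normalizer_iff]
    rintro _ ⟨σ, -, rfl⟩ _ ⟨u, rfl⟩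
    exact ⟨_, (permFst_conj_fibrewiseShift σ u).symm⟩
  have hdisj : Disjoint E R :=
    (disjoint_range_fibrewiseShift_permFst (Fin (n / p)) p).mono_right (Subgroup.map_le_range _ _)
  have hsup : IsPGroup p (E ⊔ R : Subgroup _) := hE.to_sup_of_normal_left' hR hnorm
  have hcardSup : Nat.card E * Nat.card R ≤ Nat.card (E ⊔ R : Subgroup _) := by
    rw [← Nat.card_prod]
    refine Nat.card_le_card_of_injective
      (fun x : E × R => (⟨x.1 * x.2, Subgroup.mul_mem_sup x.1.2 x.2.2⟩ : (E ⊔ R : Subgroup _)))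
      fun x y h => Subgroup.mul_injective_of_disjoint hdisj (congrArg Subtype.val h)
  have hι : Nonempty (Fin (n / p) × ZMod p ↪ Fin n) := by
    apply Function.Embedding.nonempty_of_card_le
    simpa using Nat.div_mul_le_self n p
  obtain ⟨ι⟩ := hι
  set f := Equiv.Perm.viaEmbeddingHom ι
  have hf : Function.Injective f := Equiv.Perm.viaEmbeddingHom_injective ι
  refine ⟨(E ⊔ R).map f, hsup.map f, ?_, ?_⟩
  · rw [Subgroup.card_map_of_injective hf, ← padicValNat_mul_div_factorial,
      padicValNat_factorial_mul, pow_add, mul_comm]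
    refine le_trans ?_ hcardSup
    rw [hcardE, hcardR]
    exact Nat.mul_le_mul_left _ hcard
  · rw [Subgroup.map_le_iff_le_comap]
    apply sup_le
    · rintro _ ⟨u, rfl⟩
      refine Subgroup.subset_closure
        ⟨Subgroup.mem_map_of_mem _ (Subgroup.mem_sup_left ⟨u, rfl⟩), ?_⟩
      have : u ^ p = 1 := by
        funext i
        exact orderOf_dvd_iff_pow_eq_one.1 ((orderOf_dvd_natCard _).trans (by simp))
      rw [← map_pow, ← map_pow, this, map_one, map_one]
    · rw [← Subgroup.map_le_iff_le_comap, Subgroup.map_map, Subgroup.map_le_iff_le_comap]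
      refine hgen.trans ((Subgroup.closure_le _).2 ?_)
      rintro x ⟨hx, hxp⟩
      refine Subgroup.subset_closure ⟨Subgroup.mem_map_of_mem f
        (Subgroup.mem_sup_right (Subgroup.mem_map_of_mem _ hx)), ?_⟩
      rw [← map_pow, hxp, map_one]

/-- A Sylow `p`-subgroup of a symmetric group is generated by its elements of exponent `p`. -/
theorem Sylow.perm_fin_le_of_forall_pow_eq_one {p : ℕ} [Fact p.Prime] {n : ℕ}
    (T : Sylow p (Equiv.Perm (Fin n))) {B : Subgroup (Equiv.Perm (Fin n))}
    (h : ∀ x ∈ T, x ^ p = 1 → x ∈ B) : (T : Subgroup (Equiv.Perm (Fin n))) ≤ B := by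
  obtain ⟨P, hP, hcard, hgen⟩ := exists_isPGroup_perm_fin_le_closure p n
  obtain ⟨U, hU⟩ := hP.exists_le_sylow
  have hPU : P = U := by
    refine Subgroup.eq_of_le_of_card_ge hU ?_
    rw [U.card_eq_multiplicity, Nat.card_perm, Nat.card_fin, Nat.factorization_def _ Fact.out]
    exact hcard
  obtain ⟨g, rfl⟩ := MulAction.exists_smul_eq (Equiv.Perm (Fin n)) U T
  have key : P ≤ B.comap (MulAut.conj g).toMonoidHom := by
    refine hgen.trans ((Subgroup.closure_le _).2 ?_)
    rintro x ⟨hx, hxp⟩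
    refine h _ ?_ ?_
    · exact Subgroup.smul_mem_pointwise_smul x (MulAut.conj g) _ (hPU ▸ hx)
    · rw [← map_pow, hxp, map_one]
  rw [hPU] at key
  exact Subgroup.map_le_iff_le_comap.2 key

theorem IsPGroup.zpowers_of_pow_eq_one {G : Type*} [Group G] {p : ℕ} {x : G} (hx : x ^ p = 1) :
    IsPGroup p (Subgroup.zpowers x) :=
  IsPGroup.of_card_dvd_pow (n := 1) <| by
    rw [Nat.card_zpowers, pow_one]
    exact orderOf_dvd_of_pow_eq_one hx

theorem IsPGroup.sup_zpowers_of_commute {G : Type*} [Group G] {p : ℕ} {x y : G}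
    (hxy : Commute x y) (hx : x ^ p = 1) (hy : y ^ p = 1) :
    IsPGroup p (Subgroup.zpowers x ⊔ Subgroup.zpowers y : Subgroup G) := by
  refine (zpowers_of_pow_eq_one hx).to_sup_of_normal_right' (zpowers_of_pow_eq_one hy) ?_
  refine le_trans ?_ (Subgroup.centralizer_le_normalizer _)
  rw [Subgroup.zpowers_le, Subgroup.mem_centralizer_iff]
  rintro _ ⟨k, rfl⟩
  exact (hxy.symm.zpow_left k).eq

/-- If `B` is strongly closed in `T` on elements of exponent `p`, then the set of such elements
having a conjugate in `B` is closed under products of commuting elements. -/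
theorem exists_conj_mul_mem_of_commute {G : Type*} [Group G] [Finite G] {p : ℕ} [Fact p.Prime]
    {T : Sylow p G} {B : Subgroup G}
    (hB : ∀ b ∈ B, b ^ p = 1 → ∀ g : G, g * b * g⁻¹ ∈ T → g * b * g⁻¹ ∈ B)
    {x y : G} (hxy : Commute x y) (hx : x ^ p = 1) (hy : y ^ p = 1)
    (hxB : ∃ g : G, g * x * g⁻¹ ∈ B) (hyB : ∃ g : G, g * y * g⁻¹ ∈ B) :
    ∃ g : G, g * (x * y) * g⁻¹ ∈ B := by
  obtain ⟨U, hU⟩ := (IsPGroup.sup_zpowers_of_commute hxy hx hy).exists_le_sylow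
  obtain ⟨g, rfl⟩ := MulAction.exists_smul_eq G U T
  have key : ∀ z ∈ U, z ^ p = 1 → (∃ h : G, h * z * h⁻¹ ∈ B) → g * z * g⁻¹ ∈ B := by
    rintro z hzU hz ⟨h, hh⟩
    have hconj : g * h⁻¹ * (h * z * h⁻¹) * (g * h⁻¹)⁻¹ = g * z * g⁻¹ := by group
    rw [← hconj]
    refine hB _ hh (by rw [conj_pow, hz]; group) _ ?_
    rw [hconj]
    exact Subgroup.smul_mem_pointwise_smul z (MulAut.conj g) _ hzU
  refine ⟨g, ?_⟩
  have : g * (x * y) * g⁻¹ = g * x * g⁻¹ * (g * y * g⁻¹) := by group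
  rw [this]
  exact B.mul_mem (key x (hU (Subgroup.mem_sup_left (Subgroup.mem_zpowers x))) hx hxB)
    (key y (hU (Subgroup.mem_sup_right (Subgroup.mem_zpowers y))) hy hyB)

theorem Equiv.Perm.Disjoint.pow_eq_one_of_mul {α : Type*} {σ τ : Equiv.Perm α}
    (h : σ.Disjoint τ) {k : ℕ} (hk : (σ * τ) ^ k = 1) : σ ^ k = 1 ∧ τ ^ k = 1 := by
  rwa [h.commute.mul_pow, (h.pow_disjoint_pow k k).mul_eq_one_iff] at hk

theorem Equiv.Perm.IsCycle.isConj_sq_mul {α : Type*} [Fintype α] [DecidableEq α] {p : ℕ}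
    [Fact p.Prime] (hodd : Odd p) {d r : Equiv.Perm α} (hd : d.IsCycle) (hdp : d ^ p = 1)
    (hdr : d.Disjoint r) : IsConj (d * r) (d ^ 2 * r) := by
  have hord : orderOf d = p := orderOf_eq_prime_iff.2 ⟨hdp, hd.ne_one⟩
  have hcop : Nat.Coprime 2 (orderOf d) := by
    rw [hord]; exact hodd.coprime_two_left
  have hcyc : (d ^ 2).IsCycle := hd.pow_iff.2 hcop
  have hdr' : (d ^ 2).Disjoint r := by simpa using hdr.pow_disjoint_pow 2 1
  rw [isConj_iff_cycleType_eq, hdr.cycleType_mul, hdr'.cycleType_mul, hd.cycleType,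
    hcyc.cycleType, support_pow_coprime hcop]

/-- If `B` is strongly closed in `T` on elements of exponent `p` and contains one of order `p`,
then every permutation of exponent `p` has a conjugate in `B`. -/
theorem exists_conj_mem_of_pow_eq_one {α : Type*} [Fintype α] [DecidableEq α] {p : ℕ}
    [Fact p.Prime] (hodd : Odd p)
    {T : Sylow p (Equiv.Perm α)} {B : Subgroup (Equiv.Perm α)}
    (hB : ∀ b ∈ B, b ^ p = 1 → ∀ g : Equiv.Perm α, g * b * g⁻¹ ∈ T → g * b * g⁻¹ ∈ B)
    {a : Equiv.Perm α} (haB : a ∈ B) (ha : a ^ p = 1) (ha1 : a ≠ 1)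
    (x : Equiv.Perm α) (hx : x ^ p = 1) : ∃ g : Equiv.Perm α, g * x * g⁻¹ ∈ B := by
  have conj_trans : ∀ {y z : Equiv.Perm α}, IsConj y z → (∃ g : Equiv.Perm α, g * y * g⁻¹ ∈ B) →
      ∃ g : Equiv.Perm α, g * z * g⁻¹ ∈ B := by
    rintro y z hyz ⟨g, hg⟩
    obtain ⟨c, rfl⟩ := isConj_iff.1 hyz
    exact ⟨g * c⁻¹, by convert! hg using 1; group⟩
  obtain ⟨d, hd⟩ := Finset.nonempty_iff_ne_empty.2
    (mt Equiv.Perm.cycleFactorsFinset_eq_empty_iff.1 ha1)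
  have hdc := (Equiv.Perm.mem_cycleFactorsFinset_iff.1 hd).1
  have hdr : d.Disjoint (a * d⁻¹) :=
    (Equiv.Perm.disjoint_mul_inv_of_mem_cycleFactorsFinset hd).symm
  have hmul : d * (a * d⁻¹) = a := by rw [hdr.commute.eq]; group
  obtain ⟨hdp, -⟩ := hdr.pow_eq_one_of_mul (hmul.symm ▸ ha)
  have hda : Commute d a := by
    have := (Commute.refl d).mul_right hdr.commute
    rwa [hmul] at this
  have haC : ∃ g : Equiv.Perm α, g * a * g⁻¹ ∈ B := ⟨1, by simpa using haB⟩
  have haC' : ∃ g : Equiv.Perm α, g * a⁻¹ * g⁻¹ ∈ B := ⟨1, by simpa using haB⟩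
  have hdaC : ∃ g : Equiv.Perm α, g * (d * a) * g⁻¹ ∈ B := by
    refine conj_trans ?_ haC
    have := hdc.isConj_sq_mul hodd hdp hdr
    rwa [hmul, pow_two, mul_assoc, hmul] at this
  have hdC : ∃ g : Equiv.Perm α, g * d * g⁻¹ ∈ B := by
    have := exists_conj_mul_mem_of_commute hB
      ((hda.mul_left (Commute.refl a)).inv_right) (by rw [hda.mul_pow, hdp, ha, one_mul])
      (by rw [inv_pow, ha, inv_one]) hdaC haC'
    rwa [mul_inv_cancel_right] at this
  have hdord : orderOf d = p := orderOf_eq_prime_iff.2 ⟨hdp, hdc.ne_one⟩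
  induction x using Equiv.Perm.cycle_induction_on with
  | base_one => exact ⟨1, by simp⟩
  | base_cycles σ hσ =>
    refine conj_trans (hdc.isConj hσ ?_) hdC
    rw [← hdc.orderOf, ← hσ.orderOf, hdord, orderOf_eq_prime_iff.2 ⟨hx, hσ.ne_one⟩]
  | induction_disjoint σ τ hστ _ ihσ ihτ =>
    obtain ⟨h1, h2⟩ := hστ.pow_eq_one_of_mul hx
    exact exists_conj_mul_mem_of_commute hB hστ.commute h1 h2 (ihσ h1) (ihτ h2)

/-- Two permutations of exponent `p` on at least `p + 2` letters that are conjugate in the symmetric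
group are conjugate under the alternating group. -/
theorem alternatingGroup.exists_conj_eq_of_pow_eq_one {α : Type*} [Fintype α] [DecidableEq α]
    {p : ℕ} [Fact p.Prime] (hα : p + 2 ≤ Fintype.card α) {a : Equiv.Perm α} (ha : a ^ p = 1)
    (g : Equiv.Perm α) : ∃ h ∈ alternatingGroup α, h * a * h⁻¹ = g * a * g⁻¹ := by
  by_cases hg : g ∈ alternatingGroup α
  · exact ⟨g, hg, rfl⟩
  have hcent : ¬ Subgroup.centralizer {a} ≤ alternatingGroup α := by
    intro hle
    obtain ⟨-, hcard, hcount⟩ := Equiv.Perm.centralizer_le_alternating_iff.1 hle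
    have hrep := Equiv.Perm.cycleType_of_pow_prime_eq_one ha
    have h1 := hcount p
    rw [hrep, Multiset.count_replicate_self] at h1
    rw [hrep, Multiset.sum_replicate, smul_eq_mul] at hcard
    have := Nat.mul_le_mul_right p h1
    omega
  obtain ⟨c, hc, hcalt⟩ := SetLike.not_le_iff_exists.1 hcent
  refine ⟨g * c, ?_, ?_⟩
  · rw [Equiv.Perm.mem_alternatingGroup] at hg hcalt ⊢
    rw [map_mul, (Int.units_eq_one_or _).resolve_left hg,
      (Int.units_eq_one_or _).resolve_left hcalt]
    rfl
  · have : a * c = c * a := Subgroup.mem_centralizer_iff.1 hc a rfl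
    rw [mul_inv_rev, mul_assoc g, ← this]
    group

theorem IsPGroup.le_alternatingGroup {α : Type*} [Fintype α] [DecidableEq α] {p : ℕ}
    (hodd : Odd p) {P : Subgroup (Equiv.Perm α)} (hP : IsPGroup p P) : P ≤ alternatingGroup α := by
  intro x hx
  obtain ⟨k, hk⟩ := hP ⟨x, hx⟩
  have hk' : x ^ p ^ k = 1 := congrArg Subtype.val hk
  rw [Equiv.Perm.mem_alternatingGroup]
  rcases Int.units_eq_one_or (Equiv.Perm.sign x) with h | h
  · exact h
  · have := congrArg Equiv.Perm.sign hk'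
    rw [map_pow, h, (hodd.pow).neg_one_pow, map_one] at this
    exact absurd this (by decide)

theorem Sylow.exists_map_subtype_alternatingGroup_eq {α : Type*} [Fintype α] [DecidableEq α]
    {p : ℕ} (hodd : Odd p) (S : Sylow p (alternatingGroup α)) :
    ∃ T : Sylow p (Equiv.Perm α),
      (S : Subgroup (alternatingGroup α)).map (alternatingGroup α).subtype = T := by
  obtain ⟨T, hT⟩ := (S.isPGroup'.map (alternatingGroup α).subtype).exists_le_sylow
  refine ⟨T, le_antisymm hT fun x hx => ?_⟩
  have hcomap := S.is_maximal' (T.isPGroup'.comap_subtype (K := alternatingGroup α))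
    (Subgroup.map_le_iff_le_comap.1 hT)
  have hxalt := T.isPGroup'.le_alternatingGroup hodd hx
  refine ⟨⟨x, hxalt⟩, ?_, rfl⟩
  change _ ∈ (S : Subgroup (alternatingGroup α))
  rw [← hcomap]
  exact hx

theorem Sylow.card_perm_fin_dvd_of_lt {p : ℕ} [hp : Fact p.Prime] {n : ℕ} (hn : n < 2 * p)
    (T : Sylow p (Equiv.Perm (Fin n))) : Nat.card T ∣ p := by
  have hdiv : n / p < 2 := Nat.div_lt_of_lt_mul (by omega)
  rw [T.card_eq_multiplicity, Nat.card_perm, Nat.card_fin, Nat.factorization_def _ hp.out,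
    ← padicValNat_mul_div_factorial, padicValNat_factorial_mul]
  interval_cases n / p <;> simp

/-- For an odd prime `p` and `n ≥ 5`, every nontrivial strongly closed `p`-subgroup
of the alternating group `Alt(n)` is a full Sylow `p`-subgroup. -/
theorem alternating_stronglyClosed_eq_sylow
    (p : ℕ) (hp : p.Prime) (hodd : Odd p) (n : ℕ) (hn : 5 ≤ n)
    [Fact p.Prime] (S : Sylow p (alternatingGroup (Fin n)))
    (A : Subgroup (alternatingGroup (Fin n))) (hAS : A ≤ S) (hA : A ≠ ⊥)
    (hsc : IsStronglyClosed A S) :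
    A = S := by
  obtain ⟨T, hT⟩ := S.exists_map_subtype_alternatingGroup_eq hodd
  rcases lt_or_ge n (p + 2) with hsmall | hlarge
  · have hp2 := hp.two_le
    have hp3 : p ≠ 2 := by rintro rfl; exact absurd hodd (by decide)
    have hcard : Nat.card S ∣ p := by
      have := T.card_perm_fin_dvd_of_lt (by omega)
      rwa [← hT, Subgroup.card_map_of_injective (Subgroup.subtype_injective _)] at this
    refine Subgroup.eq_of_le_of_card_ge hAS (Nat.le_of_dvd Nat.card_pos ?_)
    have hcardA : Nat.card A = p := ((Nat.dvd_prime hp).1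
      ((Subgroup.card_dvd_of_le hAS).trans hcard)).resolve_left
        (fun h => hA (Subgroup.card_eq_one.1 h))
    rwa [hcardA]
  set B := A.map (alternatingGroup (Fin n)).subtype
  have hB : ∀ b ∈ B, b ^ p = 1 → ∀ g : Equiv.Perm (Fin n), g * b * g⁻¹ ∈ T →
      g * b * g⁻¹ ∈ B := by
    rintro _ ⟨b, hb, rfl⟩ hbp g hg
    obtain ⟨h, hh, heq⟩ := alternatingGroup.exists_conj_eq_of_pow_eq_one
      (by simpa using hlarge) hbp g
    rw [← heq] at hg ⊢
    refine ⟨⟨h, hh⟩ * b * ⟨h, hh⟩⁻¹, hsc b hb _ ?_, rfl⟩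
    change _ ∈ (T : Subgroup (Equiv.Perm (Fin n))) at hg
    rw [← hT] at hg
    obtain ⟨s, hs, hseq⟩ := hg
    convert! hs using 1
    exact Subtype.ext hseq.symm
  have hpA : p ∣ Nat.card A := by
    obtain ⟨k, hk⟩ := (S.isPGroup'.to_le hAS).exists_card_eq
    rw [hk]
    refine dvd_pow_self p ?_
    rintro rfl
    exact hA (Subgroup.card_eq_one.1 (by simpa using hk))
  obtain ⟨a, ha⟩ := exists_prime_orderOf_dvd_card' p hpA
  obtain ⟨hap, ha1⟩ := orderOf_eq_prime_iff.1 ha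
  have hconj := exists_conj_mem_of_pow_eq_one hodd hB
    (a := ((a : alternatingGroup (Fin n)) : Equiv.Perm (Fin n)))
    (Subgroup.mem_map_of_mem _ a.2) (by exact_mod_cast hap) (by exact_mod_cast ha1)
  have hTB : (T : Subgroup (Equiv.Perm (Fin n))) ≤ B := by
    refine T.perm_fin_le_of_forall_pow_eq_one fun x hxT hx => ?_
    obtain ⟨g, hg⟩ := hconj x hx
    have hconjx : g⁻¹ * (g * x * g⁻¹) * g⁻¹⁻¹ = x := by group
    rw [← hconjx]
    exact hB _ hg (by rw [conj_pow, hx]; group) _ (by rwa [hconjx])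
  refine le_antisymm hAS ?_
  rw [← hT] at hTB
  exact (Subgroup.map_le_map_iff_of_injective (Subgroup.subtype_injective _)).1 hTB
end

section
/- Let p be an odd prime, n a natural number, and let z₁, …, z_s (with s ≥ 3) be cycles of length p in the alternating group Alt(n) whose supports are pairwise disjoint; let E = ⟨z₁, …, z_s⟩ be the (elementary abelian) subgroup they generate. Let S be a Sylow p-subgroup of Alt(n) with E ≤ S, and let A be a subgroup of S that is strongly closed in S with respect to Alt(n). If A ∩ E ≠ 1, then E ≤ A. -/
/-- A nontrivial power of a cycle of prime length `p` is again a cycle of length `p`. -/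
theorem Equiv.Perm.IsCycle.cycleType_zpow_of_prime {α : Type*} [Fintype α] [DecidableEq α]
    {p : ℕ} [Fact p.Prime] {c : Equiv.Perm α} (hc : c.IsCycle) (hcard : c.support.card = p)
    {a : ℤ} (ha : c ^ a ≠ 1) : (c ^ a).cycleType = {p} := by
  have hp : p.Prime := Fact.out
  have hcp : c ^ p = 1 := by rw [← hcard, ← hc.orderOf, pow_orderOf_eq_one]
  have hord : orderOf (c ^ a) = p := by
    refine orderOf_eq_prime ?_ ha
    rw [← zpow_natCast, zpow_comm, zpow_natCast, hcp, one_zpow]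
  have hle : (c ^ a).support.card ≤ p := hcard ▸ Finset.card_le_card (support_zpow_le c a)
  have hcyc : (c ^ a).IsCycle :=
    isCycle_of_prime_order (hord.symm ▸ hp) (by have := hp.pos; omega)
  rw [hcyc.cycleType, ← hcyc.orderOf, hord]

/-- The cycle type of a nontrivial power of a `p`-cycle times a permutation disjoint from it. -/
theorem Equiv.Perm.Disjoint.cycleType_zpow_mul_of_prime {α : Type*} [Fintype α] [DecidableEq α]
    {p : ℕ} [Fact p.Prime] {c f : Equiv.Perm α} (hf : c.Disjoint f) (hc : c.IsCycle)
    (hcard : c.support.card = p) {a : ℤ} (ha : c ^ a ≠ 1) :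
    (c ^ a * f).cycleType = {p} + f.cycleType := by
  have hdisj : (c ^ a).Disjoint f := by simpa using hf.zpow_disjoint_zpow a 1
  rw [hdisj.cycleType_mul, hc.cycleType_zpow_of_prime hcard ha]

/-- If the centralizer of an even permutation `σ` contains an odd permutation, every even
permutation of the same cycle type is conjugate to `σ` in the alternating group. -/
theorem alternatingGroup.isConj_of_cycleType_eq {α : Type*} [Fintype α] [DecidableEq α]
    {σ τ : alternatingGroup α} (h : (σ : Equiv.Perm α).cycleType = (τ : Equiv.Perm α).cycleType)
    (hσ : ¬ Subgroup.centralizer {(σ : Equiv.Perm α)} ≤ alternatingGroup α) : IsConj σ τ := by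
  obtain ⟨g, hg⟩ := isConj_iff.mp (Equiv.Perm.isConj_iff_cycleType_eq.mpr h)
  obtain ⟨k, hk, hkodd⟩ := SetLike.not_le_iff_exists.mp hσ
  rw [Subgroup.mem_centralizer_singleton_iff] at hk
  by_cases hgeven : g ∈ alternatingGroup α
  · exact isConj_iff.mpr ⟨⟨g, hgeven⟩, Subtype.ext hg⟩
  · have hgk : g * k ∈ alternatingGroup α := by
      rw [Equiv.Perm.mem_alternatingGroup] at hgeven hkodd ⊢
      rw [Equiv.Perm.sign_mul, (Int.units_eq_one_or _).resolve_left hgeven,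
        (Int.units_eq_one_or _).resolve_left hkodd]
      rfl
    refine isConj_iff.mpr ⟨⟨g * k, hgk⟩, Subtype.ext ?_⟩
    calc g * k * σ * (g * k)⁻¹ = g * (k * σ * k⁻¹) * g⁻¹ := by group
      _ = τ := by rw [hk, mul_inv_cancel_right, hg]

section DisjointFamily

variable {α ι : Type*} {z : ι → Equiv.Perm α}

/-- An element of the group generated by pairwise disjoint permutations splits as a power of a
given generator times a permutation disjoint from that generator. -/
theorem Equiv.Perm.exists_zpow_mul_disjoint_of_mem_closure
    (hz : Pairwise fun i j => (z i).Disjoint (z j)) (i : ι) {e : Equiv.Perm α}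
    (he : e ∈ Subgroup.closure (Set.range z)) :
    ∃ (a : ℤ) (f : Equiv.Perm α), e = z i ^ a * f ∧ (z i).Disjoint f := by
  induction he using Subgroup.closure_induction with
  | mem x hx =>
    obtain ⟨j, rfl⟩ := hx
    by_cases hij : i = j
    · subst hij
      exact ⟨1, 1, by simp, Equiv.Perm.disjoint_one_right _⟩
    · exact ⟨0, z j, by simp, hz hij⟩
  | one => exact ⟨0, 1, by simp, Equiv.Perm.disjoint_one_right _⟩
  | mul x y _ _ hx hy =>
    obtain ⟨a, f, rfl, hf⟩ := hx
    obtain ⟨b, g, rfl, hg⟩ := hy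
    refine ⟨a + b, f * g, ?_, hf.mul_right hg⟩
    rw [zpow_add, mul_assoc, ← mul_assoc f, (hf.commute.symm.zpow_right b).eq]
    simp only [mul_assoc]
  | inv x _ hx =>
    obtain ⟨a, f, rfl, hf⟩ := hx
    refine ⟨-a, f⁻¹, ?_, hf.inv_right⟩
    rw [mul_inv_rev, ← zpow_neg, (hf.commute.symm.inv_left.zpow_right (-a)).eq]

/-- A point fixed by all generators is fixed by the group they generate. -/
theorem Equiv.Perm.apply_eq_self_of_mem_closure {x : α} (hx : ∀ i, z i x = x)
    {e : Equiv.Perm α} (he : e ∈ Subgroup.closure (Set.range z)) : e x = x := by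
  have hle : Subgroup.closure (Set.range z) ≤ MulAction.stabilizer (Equiv.Perm α) x := by
    rw [Subgroup.closure_le]
    rintro _ ⟨i, rfl⟩
    exact hx i
  exact hle he

/-- A nontrivial element of the group generated by pairwise disjoint permutations has a nontrivial
component along some generator, and its complementary component lies in the group as well. -/
theorem Equiv.Perm.exists_zpow_ne_one_mul_disjoint_of_mem_closure
    (hz : Pairwise fun i j => (z i).Disjoint (z j)) {e : Equiv.Perm α}
    (he : e ∈ Subgroup.closure (Set.range z)) (hne : e ≠ 1) :
    ∃ (i : ι) (a : ℤ), ∃ f ∈ Subgroup.closure (Set.range z),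
      e = z i ^ a * f ∧ (z i).Disjoint f ∧ z i ^ a ≠ 1 := by
  obtain ⟨x, hx⟩ : ∃ x, e x ≠ x := by
    contrapose! hne
    exact Equiv.ext hne
  obtain ⟨i, hi⟩ : ∃ i, z i x ≠ x := by
    contrapose! hx
    exact apply_eq_self_of_mem_closure hx he
  obtain ⟨a, f, rfl, hf⟩ := exists_zpow_mul_disjoint_of_mem_closure hz i he
  have hmem : z i ^ a ∈ Subgroup.closure (Set.range z) :=
    zpow_mem (Subgroup.subset_closure (Set.mem_range_self i)) a
  refine ⟨i, a, f, (Subgroup.mul_mem_cancel_left _ hmem).mp he, rfl, hf, fun h => hx ?_⟩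
  rw [h, one_mul]
  exact (hf x).resolve_left hi

/-- Every nontrivial element of the group generated by at least two pairwise disjoint cycles of
prime length commutes with some odd permutation. -/
theorem Equiv.Perm.not_centralizer_le_alternatingGroup_of_mem_closure [Fintype α] [DecidableEq α]
    [Nontrivial ι] {p : ℕ} [Fact p.Prime]
    (hz : Pairwise fun i j => (z i).Disjoint (z j)) (hcyc : ∀ i, (z i).IsCycle)
    (hlen : ∀ i, (z i).support.card = p) {e : Equiv.Perm α}
    (he : e ∈ Subgroup.closure (Set.range z)) (hne : e ≠ 1) :
    ¬ Subgroup.centralizer {e} ≤ alternatingGroup α := by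
  rw [centralizer_le_alternating_iff]
  rintro ⟨-, hcard, hcount⟩
  obtain ⟨i, a, f, hf, rfl, hdisj, ha⟩ :=
    exists_zpow_ne_one_mul_disjoint_of_mem_closure hz he hne
  have hp : 2 ≤ p := (Fact.out : p.Prime).two_le
  rw [hdisj.cycleType_zpow_mul_of_prime (hcyc i) (hlen i) ha] at hcard hcount
  by_cases hf1 : f = 1
  · obtain ⟨j, hj⟩ := exists_ne i
    have hunion : (z i * z j).support.card = p + p := by
      rw [(hz hj.symm).card_support_mul, hlen, hlen]
    have huniv := Finset.card_le_univ (z i * z j).support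
    simp only [hf1, cycleType_one, add_zero, Multiset.sum_singleton] at hcard
    omega
  · obtain ⟨j, b, g, -, rfl, hdisj', hb⟩ :=
      exists_zpow_ne_one_mul_disjoint_of_mem_closure hz hf hf1
    have hp2 := hcount p
    rw [hdisj'.cycleType_zpow_mul_of_prime (hcyc j) (hlen j) hb] at hp2
    simp at hp2

end DisjointFamily

/-- Let `z 1, …, z s` (`s ≥ 3`) be `p`-cycles in `Alt(n)` with pairwise disjoint
supports, `E` the subgroup they generate, `S` a Sylow `p`-subgroup containing `E`,
and `A ≤ S` strongly closed with respect to `Alt(n)`. If `A ∩ E ≠ 1` then `E ≤ A`. -/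
theorem disjoint_cycles_in_stronglyClosed
    (p : ℕ) (hp : p.Prime) (hodd : Odd p) (n s : ℕ) (hs : 3 ≤ s)
    [Fact p.Prime]
    (z : Fin s → alternatingGroup (Fin n))
    (hcyc : ∀ i, Equiv.Perm.IsCycle (z i : Equiv.Perm (Fin n)))
    (hlen : ∀ i, (z i : Equiv.Perm (Fin n)).support.card = p)
    (hdisj : ∀ i j, i ≠ j →
      Disjoint (z i : Equiv.Perm (Fin n)).support (z j : Equiv.Perm (Fin n)).support)
    (S : Sylow p (alternatingGroup (Fin n)))
    (hES : Subgroup.closure (Set.range z) ≤ S)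
    (A : Subgroup (alternatingGroup (Fin n))) (hAS : A ≤ S)
    (hsc : IsStronglyClosed A S)
    (hAE : A ⊓ Subgroup.closure (Set.range z) ≠ ⊥) :
    Subgroup.closure (Set.range z) ≤ A := by
  have : Nontrivial (Fin s) := Fin.nontrivial_iff_two_le.mpr (by omega)
  let w : Fin s → Equiv.Perm (Fin n) := fun i => z i
  have hw : Pairwise fun i j => (w i).Disjoint (w j) := fun i j hij =>
    Equiv.Perm.disjoint_iff_disjoint_support.mpr (hdisj i j hij)
  have hcoe : ∀ e ∈ Subgroup.closure (Set.range z),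
      (e : Equiv.Perm (Fin n)) ∈ Subgroup.closure (Set.range w) := by
    intro e he
    have := Subgroup.mem_map_of_mem (alternatingGroup (Fin n)).subtype he
    rwa [MonoidHom.map_closure, ← Set.range_comp] at this
  have hz : ∀ i, z i ∈ Subgroup.closure (Set.range z) := fun i => Subgroup.subset_closure ⟨i, rfl⟩
  have hfuse : ∀ e ∈ A, e ∈ Subgroup.closure (Set.range z) → e ≠ 1 →
      ∀ e' ∈ Subgroup.closure (Set.range z),
        (e : Equiv.Perm (Fin n)).cycleType = (e' : Equiv.Perm (Fin n)).cycleType → e' ∈ A := by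
    intro e heA heE hne e' he' htype
    have hconj := alternatingGroup.isConj_of_cycleType_eq htype
      (Equiv.Perm.not_centralizer_le_alternatingGroup_of_mem_closure hw hcyc hlen
        (hcoe e heE) fun h => hne (Subtype.ext h))
    obtain ⟨g, rfl⟩ := isConj_iff.mp hconj
    exact hsc e heA g (hES he')
  obtain ⟨e, ⟨heA, heE⟩, hne⟩ := (Subgroup.bot_or_exists_ne_one _).resolve_left hAE
  obtain ⟨i, a, f, -, hef, hf, ha⟩ :=
    Equiv.Perm.exists_zpow_ne_one_mul_disjoint_of_mem_closure hw (hcoe e heE)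
      fun h => hne (Subtype.ext h)
  have hord : orderOf (z i) = p := by
    rw [← Subgroup.orderOf_coe, (hcyc i).orderOf, hlen]
  have hpa : ¬ (p : ℤ) ∣ a := by
    intro h
    rw [← hord, orderOf_dvd_iff_zpow_eq_one] at h
    exact ha (congrArg Subtype.val h)
  have ha2 : w i ^ (a + a) ≠ 1 := by
    intro h
    have hdvd : (orderOf (w i) : ℤ) ∣ a + a := orderOf_dvd_iff_zpow_eq_one.mpr h
    rw [show orderOf (w i) = p by rw [(hcyc i).orderOf, hlen], ← two_mul] at hdvd
    refine ((Nat.prime_iff_prime_int.mp hp).dvd_or_dvd hdvd).elim (fun h2 => ?_) hpa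
    have : p ∣ 2 := by exact_mod_cast h2
    rw [Nat.prime_dvd_prime_iff_eq hp Nat.prime_two] at this
    subst this
    exact absurd hodd (by decide)
  have hmul : z i ^ a * e ∈ A := by
    refine hfuse e heA heE hne _
      (mul_mem (zpow_mem (hz i) a) heE) ?_
    have hcoe_mul : ((z i ^ a * e : alternatingGroup (Fin n)) : Equiv.Perm (Fin n)) =
        w i ^ (a + a) * f := by
      rw [zpow_add, mul_assoc, ← hef]
      rfl
    rw [hcoe_mul, hef, hf.cycleType_zpow_mul_of_prime (hcyc i) (hlen i) ha,
      hf.cycleType_zpow_mul_of_prime (hcyc i) (hlen i) ha2]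
  have hziA : z i ∈ A := by
    refine (Subgroup.zpowers_le.mpr ((Subgroup.mul_mem_cancel_right A heA).mp hmul)) ?_
    rw [mem_zpowers_zpow_iff, hord, Int.gcd_comm]
    exact (Int.isCoprime_iff_gcd_eq_one.mp
      ((Nat.prime_iff_prime_int.mp hp).coprime_iff_not_dvd.mpr hpa))
  rw [Subgroup.closure_le]
  rintro _ ⟨j, rfl⟩
  refine hfuse (z i) hziA (hz i) (fun h => (hcyc i).ne_one (congrArg Subtype.val h)) _ (hz j) ?_
  rw [(hcyc i).cycleType, (hcyc j).cycleType, hlen, hlen]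
end

section
/- Let p be a prime, G a finite group, S a Sylow p-subgroup of G, and Q a subgroup of S that is strongly closed in S with respect to G. Assume Q is extraspecial of width greater than 1; that is, the center Z(Q) and the commutator subgroup [Q,Q] coincide and have order p, the quotient Q/Z(Q) is elementary abelian, and |Q| ≥ p⁵. Assume further that Z(Q) ≤ Z(S). Then no element of Q ∖ Z(Q) is G-conjugate to an element of Z(Q); i.e., for all x ∈ Q with x ∉ Z(Q) and all g ∈ G, g * x * g⁻¹ ∉ Z(Q). -/
open scoped commutatorElement

/-- If all commutators are central, then `q ↦ ⁅q, x⁆` is a homomorphism to the center. -/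
def commutatorHomToCenter {H : Type*} [Group H]
    (hcomm : ∀ a b : H, ⁅a, b⁆ ∈ Subgroup.center H) (x : H) : H →* Subgroup.center H where
  toFun q := ⟨⁅q, x⁆, hcomm q x⟩
  map_one' := by simp
  map_mul' a b := by
    ext
    have h := Subgroup.mem_center_iff.1 (hcomm b x) a
    simp only [Subgroup.coe_mul]
    calc ⁅a * b, x⁆ = a * ⁅b, x⁆ * (x * a⁻¹ * x⁻¹) := by simp only [commutatorElement_def]; group
      _ = ⁅b, x⁆ * ⁅a, x⁆ := by rw [h]; simp only [commutatorElement_def]; group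
      _ = ⁅a, x⁆ * ⁅b, x⁆ := (Subgroup.mem_center_iff.1 (hcomm b x) _).symm

theorem ker_commutatorHomToCenter {H : Type*} [Group H]
    (hcomm : ∀ a b : H, ⁅a, b⁆ ∈ Subgroup.center H) (x : H) :
    (commutatorHomToCenter hcomm x).ker = Subgroup.centralizer {x} := by
  ext q
  rw [MonoidHom.mem_ker, Subgroup.mem_centralizer_singleton_iff,
    ← commutatorElement_eq_one_iff_mul_comm]
  exact Subtype.ext_iff

theorem index_centralizer_dvd_card_center {H : Type*} [Group H] [Finite H]
    (hcomm : ∀ a b : H, ⁅a, b⁆ ∈ Subgroup.center H) (x : H) :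
    (Subgroup.centralizer {x}).index ∣ Nat.card (Subgroup.center H) := by
  rw [← ker_commutatorHomToCenter hcomm x, Subgroup.index_ker]
  exact Subgroup.card_subgroup_dvd_card _

/-- In a group of class at most two with center of prime order `p` and order greater than `p ^ 3`,
the centralizer of a noncentral element is not abelian. -/
theorem exists_not_commute_in_centralizer {H : Type*} [Group H] [Finite H] {p : ℕ} (hp : p.Prime)
    (hcomm : ∀ a b : H, ⁅a, b⁆ ∈ Subgroup.center H)
    (hcard : Nat.card (Subgroup.center H) = p) (hbig : p ^ 3 < Nat.card H)
    {x : H} (hx : x ∉ Subgroup.center H) :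
    ∃ a b : H, a * x = x * a ∧ b * x = x * b ∧ a * b ≠ b * a := by
  by_contra! hab
  obtain ⟨q, hq⟩ : ∃ q : H, q * x ≠ x * q := by
    by_contra! h
    exact hx (Subgroup.mem_center_iff.2 h)
  have hindex : ∀ y : H, (Subgroup.centralizer {y}).index ∣ p := fun y =>
    hcard ▸ index_centralizer_dvd_card_center hcomm y
  set K : Subgroup H := Subgroup.centralizer {x} ⊓ Subgroup.centralizer {q} with hK
  have hle : Subgroup.centralizer {x} ≤ Subgroup.centralizer (K : Set H) := by
    intro a ha k hk
    exact hab k a (Subgroup.mem_centralizer_singleton_iff.1 hk.1)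
      (Subgroup.mem_centralizer_singleton_iff.1 ha)
  have hqK : q ∈ Subgroup.centralizer (K : Set H) := fun k hk =>
    Subgroup.mem_centralizer_singleton_iff.1 hk.2
  have htop : Subgroup.centralizer (K : Set H) = ⊤ := by
    have hmul := Subgroup.relIndex_mul_index hle
    rcases (Nat.dvd_prime hp).1 (hindex x) with h1 | h1
    · rw [Subgroup.index_eq_one] at h1
      exact top_le_iff.1 (h1 ▸ hle)
    · rw [h1] at hmul
      rcases (Nat.dvd_prime hp).1 (Dvd.intro_left _ hmul) with h2 | h2
      · exact Subgroup.index_eq_one.1 h2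
      · rw [h2] at hmul
        have h3 := Nat.eq_of_mul_eq_mul_right hp.pos (hmul.trans (one_mul p).symm)
        exact absurd (Subgroup.mem_centralizer_singleton_iff.1
          (Subgroup.relIndex_eq_one.1 h3 hqK)) hq
  have hKcenter : K ≤ Subgroup.center H := fun k hk => Subgroup.mem_center_iff.2 fun a =>
    ((htop ▸ Subgroup.mem_top a : a ∈ Subgroup.centralizer (K : Set H)) k hk).symm
  have hKcard : Nat.card K ≤ p := hcard ▸ Subgroup.card_le_of_le hKcenter
  have hKindex : K.index ≤ p * p := (Subgroup.index_inf_le).trans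
    (Nat.mul_le_mul (Nat.le_of_dvd hp.pos (hindex x)) (Nat.le_of_dvd hp.pos (hindex q)))
  have := Nat.mul_le_mul hKcard hKindex
  rw [Subgroup.card_mul_index] at this
  nlinarith

/-- If a `G`-conjugate `z` of `x` is centralized by a Sylow `p`-subgroup `S`, then some element
conjugating `x` to `z` conjugates any given `p`-subgroup centralizing `x` into `S`. -/
theorem exists_conj_eq_and_conj_mem_sylow {G : Type*} [Group G] [Finite G] {p : ℕ}
    [Fact p.Prime] (S : Sylow p G) {P : Subgroup G} (hP : IsPGroup p P) {x z g : G}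
    (hPx : P ≤ Subgroup.centralizer {x}) (hSz : (S : Subgroup G) ≤ Subgroup.centralizer {z})
    (hg : g * x * g⁻¹ = z) :
    ∃ k : G, k * x * k⁻¹ = z ∧ ∀ a ∈ P, k * a * k⁻¹ ∈ (S : Subgroup G) := by
  set C := Subgroup.centralizer {z}
  have hPC : P.map (MulAut.conj g).toMonoidHom ≤ C := by
    rintro _ ⟨a, ha, rfl⟩
    have h := Subgroup.mem_centralizer_singleton_iff.1 (hPx ha)
    refine Subgroup.mem_centralizer_singleton_iff.2 ?_
    simp only [MulEquiv.coe_toMonoidHom, MulAut.conj_apply, ← hg]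
    calc g * a * g⁻¹ * (g * x * g⁻¹) = g * (a * x) * g⁻¹ := by group
      _ = g * x * g⁻¹ * (g * a * g⁻¹) := by rw [h]; group
  obtain ⟨T, hT⟩ := ((hP.map (MulAut.conj g).toMonoidHom).comap_subtype (K := C)).exists_le_sylow
  obtain ⟨h, hh⟩ := MulAction.exists_smul_eq C T (S.subtype hSz)
  have hz := Subgroup.mem_centralizer_singleton_iff.1 h.2
  refine ⟨h * g, ?_, fun a ha => ?_⟩
  · calc (h : G) * g * x * (h * g)⁻¹ = h * (g * x * g⁻¹) * (h : G)⁻¹ := by group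
      _ = z := by rw [hg, hz]; group
  · have haC : g * a * g⁻¹ ∈ C := hPC ⟨a, ha, rfl⟩
    have haT : (⟨g * a * g⁻¹, haC⟩ : C) ∈ T := hT ⟨a, ha, rfl⟩
    have haS : h * ⟨g * a * g⁻¹, haC⟩ * h⁻¹ ∈ S.subtype hSz := by
      rw [← hh]
      exact Subgroup.smul_mem_pointwise_smul _ (MulAut.conj h) (T : Subgroup C) haT
    have : (h : G) * (g * a * g⁻¹) * (h : G)⁻¹ ∈ (S : Subgroup G) := haS
    convert this using 1
    group

/-- If `Q` is a strongly closed extraspecial subgroup of width `> 1` (so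
`Z(Q) = [Q,Q]` has order `p`, `Q/Z(Q)` is elementary abelian and `|Q| ≥ p⁵`) of a
Sylow `p`-subgroup `S` with `Z(Q) ≤ Z(S)`, then no element of `Q \ Z(Q)` is
`G`-conjugate to an element of `Z(Q)`. -/
theorem extraspecial_stronglyClosed_no_fusion_into_center
    (p : ℕ) (hp : p.Prime) (G : Type*) [Group G] [Finite G] [Fact p.Prime]
    (S : Sylow p G) (Q : Subgroup G) (hQS : Q ≤ S) (hsc : IsStronglyClosed Q S)
    (Z : Subgroup G) (hZdef : Z = Subgroup.map Q.subtype (Subgroup.center Q))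
    (hZcomm : Z = ⁅Q, Q⁆)
    (hZcard : Nat.card Z = p)
    (hexp : ∀ x ∈ Q, x ^ p ∈ Z)
    (hbig : p ^ 5 ≤ Nat.card Q)
    (hZS : ∀ x ∈ Z, ∀ y ∈ (S : Subgroup G), x * y = y * x) :
    ∀ x ∈ Q, x ∉ Z → ∀ g : G, g * x * g⁻¹ ∉ Z := by
  intro x hxQ hxZ g hgZ
  have hcard : Nat.card (Subgroup.center Q) = p := by
    rw [← hZcard, hZdef, Subgroup.card_map_of_injective Q.subtype_injective]
  have hmem : ∀ y : Q, (y : G) ∈ Z ↔ y ∈ Subgroup.center Q := fun y => by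
    rw [hZdef]
    exact Subgroup.mem_map_iff_mem Q.subtype_injective
  have hcommZ : ∀ a ∈ Q, ∀ b ∈ Q, ⁅a, b⁆ ∈ Z := fun a ha b hb =>
    hZcomm ▸ Subgroup.commutator_mem_commutator ha hb
  obtain ⟨⟨a, haQ⟩, ⟨b, hbQ⟩, hax, hbx, hab⟩ := exists_not_commute_in_centralizer hp
    (fun a b : Q => (hmem _).1 (hcommZ a a.2 b b.2)) hcard
    ((Nat.pow_lt_pow_right hp.one_lt (by norm_num)).trans_le hbig)
    (x := ⟨x, hxQ⟩) (fun h => hxZ ((hmem _).2 h))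
  simp only [MulMemClass.mk_mul_mk, ne_eq, Subtype.mk.injEq] at hax hbx hab
  have hpgroup : IsPGroup p (Q ⊓ Subgroup.centralizer {x} : Subgroup G) :=
    S.isPGroup'.to_le (inf_le_left.trans hQS)
  obtain ⟨k, hkx, hk⟩ := exists_conj_eq_and_conj_mem_sylow S hpgroup inf_le_right
    (fun y hy => Subgroup.mem_centralizer_singleton_iff.2 (hZS _ hgZ y hy).symm) rfl
  have hkQ : ∀ c ∈ Q, c * x = x * c → k * c * k⁻¹ ∈ Q := fun c hc hcx =>
    hsc c hc k (hk c ⟨hc, Subgroup.mem_centralizer_singleton_iff.2 hcx⟩)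
  have hconj : k * ⁅a, b⁆ * k⁻¹ ∈ Z := by
    have h := hcommZ _ (hkQ a haQ hax) _ (hkQ b hbQ hbx)
    convert h using 1
    simp only [commutatorElement_def]
    group
  have hne : (⟨k * ⁅a, b⁆ * k⁻¹, hconj⟩ : Z) ≠ 1 := fun h =>
    hab (commutatorElement_eq_one_iff_mul_comm.1 (conj_eq_one_iff.1 (Subtype.ext_iff.1 h)))
  obtain ⟨n, hn⟩ := Subgroup.mem_zpowers_iff.1
    (mem_zpowers_of_prime_card (g' := (⟨g * x * g⁻¹, hgZ⟩ : Z)) hZcard hne)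
  have hn' : (k * ⁅a, b⁆ * k⁻¹) ^ n = k * x * k⁻¹ := by
    rw [hkx]
    exact congrArg Subtype.val hn
  rw [conj_zpow] at hn'
  have hxn : ⁅a, b⁆ ^ n = x := mul_left_cancel (mul_right_cancel hn')
  exact hxZ (hxn ▸ Z.zpow_mem (hcommZ a haQ b hbQ) n)
end

section
/- Let F be a finite field whose cardinality q satisfies q ≡ 1 (mod 3), and let SL(3,F) denote the group of 3×3 matrices over F of determinant 1. Then any two elements of SL(3,F) that have order 3 and do not lie in the center of SL(3,F) are conjugate in SL(3,F). -/
open Matrix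

/-- The Cayley–Hamilton identity in degree three. -/
theorem Matrix.pow_three_fin_three {R : Type*} [CommRing R] (A : Matrix (Fin 3) (Fin 3) R) :
    A ^ 3 = A.trace • A ^ 2 - A.adjugate.trace • A + A.det • (1 : Matrix (Fin 3) (Fin 3) R) := by
  ext i j
  fin_cases i <;> fin_cases j <;>
    simp [pow_succ, Matrix.mul_apply, Fin.sum_univ_three, Matrix.trace_fin_three,
      Matrix.adjugate_fin_three, Matrix.det_fin_three] <;> ring

/-- The characteristic polynomial of a matrix of size three, evaluated at `c`. -/
theorem Matrix.det_sub_smul_one_fin_three {R : Type*} [CommRing R]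
    (A : Matrix (Fin 3) (Fin 3) R) (c : R) :
    (A - c • (1 : Matrix (Fin 3) (Fin 3) R)).det
      = A.det - c * A.adjugate.trace + c ^ 2 * A.trace - c ^ 3 := by
  simp [Matrix.trace_fin_three, Matrix.adjugate_fin_three, Matrix.det_fin_three]
  ring

/-- A non-scalar matrix of size three with `A ^ 3 = 1` and determinant one has every cube root of
unity as an eigenvalue. -/
theorem Matrix.exists_mulVec_eq_smul_of_pow_three_eq_one {F : Type*} [Field F]
    {A : Matrix (Fin 3) (Fin 3) F} (hA : A ^ 3 = 1) (hdet : A.det = 1)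
    (hscalar : ∀ r : F, A ≠ r • (1 : Matrix (Fin 3) (Fin 3) F)) {c : F} (hc : c ^ 3 = 1) :
    ∃ v : Fin 3 → F, v ≠ 0 ∧ A *ᵥ v = c • v := by
  have h : A.trace • A ^ 2 = A.adjugate.trace • A := by
    have := A.pow_three_fin_three
    rw [hA, hdet, one_smul, right_eq_add, sub_eq_zero] at this
    exact this
  have h' : A.trace • A = A.adjugate.trace • (1 : Matrix (Fin 3) (Fin 3) F) := by
    have := congrArg (· * A ^ 2) h
    simpa only [smul_mul_assoc, ← pow_add, ← pow_succ', Nat.reduceAdd, hA, pow_succ A 3, one_mul]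
      using this
  have ht : A.trace = 0 := by
    by_contra ht
    refine hscalar (A.trace⁻¹ * A.adjugate.trace) ?_
    rw [mul_smul, ← h', smul_smul, inv_mul_cancel₀ ht, one_smul]
  have hs : A.adjugate.trace = 0 := by
    rw [ht, zero_smul, eq_comm, smul_eq_zero] at h'
    exact h'.resolve_right one_ne_zero
  have hd : (A - c • (1 : Matrix (Fin 3) (Fin 3) F)).det = 0 := by
    rw [A.det_sub_smul_one_fin_three, ht, hs, hdet, hc]
    ring
  obtain ⟨v, hv, hAv⟩ := Matrix.exists_mulVec_eq_zero_iff.mpr hd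
  refine ⟨v, hv, ?_⟩
  rwa [Matrix.sub_mulVec, Matrix.smul_mulVec, Matrix.one_mulVec, sub_eq_zero] at hAv

/-- A matrix with distinct eigenvalues `d i` is diagonalized by a matrix of determinant one. -/
theorem Matrix.exists_det_eq_one_mul_eq_mul_diagonal {F n : Type*} [Field F] [Fintype n]
    [DecidableEq n] [Nonempty n] {A : Matrix n n F} {d : n → F} (hd : Function.Injective d)
    (h : ∀ i, ∃ v : n → F, v ≠ 0 ∧ A *ᵥ v = d i • v) :
    ∃ P : Matrix n n F, P.det = 1 ∧ A * P = P * diagonal d := by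
  choose v hv hAv using h
  have hli : LinearIndependent F v := by
    refine Module.End.eigenvectors_linearIndependent' (Matrix.toLin' A) d hd v fun i => ?_
    exact ⟨Module.End.mem_eigenspace_iff.mpr (by simpa using hAv i), hv i⟩
  have hunit : IsUnit (Matrix.of v)ᵀ := by
    rw [← Matrix.linearIndependent_cols_iff_isUnit]
    exact hli
  have hdet : (Matrix.of v)ᵀ.det ≠ 0 := ((Matrix.isUnit_iff_isUnit_det _).mp hunit).ne_zero
  have hcomm : A * (Matrix.of v)ᵀ = (Matrix.of v)ᵀ * diagonal d := by
    ext i j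
    rw [Matrix.mul_diagonal]
    simpa [Matrix.mul_apply, Matrix.mulVec, dotProduct, mul_comm] using congrFun (hAv j) i
  let i₀ : n := Classical.arbitrary n
  refine ⟨(Matrix.of v)ᵀ * diagonal (Pi.mulSingle i₀ (Matrix.of v)ᵀ.det⁻¹), ?_, ?_⟩
  · rw [Matrix.det_mul, Matrix.det_diagonal, Fintype.prod_pi_mulSingle', mul_inv_cancel₀ hdet]
  · rw [← mul_assoc, hcomm, mul_assoc, mul_assoc, (Matrix.commute_diagonal _ _).eq]

/-- A finite field of cardinality `1` modulo `3` contains a primitive cube root of unity. -/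
theorem FiniteField.exists_isPrimitiveRoot_three {F : Type*} [Field F] [Fintype F]
    (hq : Fintype.card F ≡ 1 [MOD 3]) : ∃ w : F, IsPrimitiveRoot w 3 := by
  classical
  have h3 : 3 ∣ Fintype.card Fˣ := by
    rw [Fintype.card_units]
    exact (Nat.modEq_iff_dvd' Fintype.card_pos).mp hq.symm
  have : Fact (Nat.Prime 3) := ⟨Nat.prime_three⟩
  obtain ⟨u, hu⟩ := exists_prime_orderOf_dvd_card 3 h3
  exact ⟨u, IsPrimitiveRoot.coe_units_iff.mpr (hu ▸ IsPrimitiveRoot.orderOf u)⟩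

/-- A noncentral element of order three in `SL(3, F)` is diagonalized within `SL(3, F)`, with
eigenvalues the cube roots of unity. -/
theorem Matrix.SpecialLinearGroup.exists_mul_eq_mul_diagonal {F : Type*} [Field F] {w : F}
    (hw : IsPrimitiveRoot w 3) {x : SpecialLinearGroup (Fin 3) F} (hx : orderOf x = 3)
    (hxc : x ∉ Subgroup.center (SpecialLinearGroup (Fin 3) F)) :
    ∃ P : SpecialLinearGroup (Fin 3) F,
      (x : Matrix (Fin 3) (Fin 3) F) * P = P * diagonal fun i : Fin 3 => w ^ (i : ℕ) := by
  have hx3 : (x : Matrix (Fin 3) (Fin 3) F) ^ 3 = 1 := by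
    have h : x ^ 3 = 1 := orderOf_dvd_iff_pow_eq_one.mp hx.dvd
    rw [← SpecialLinearGroup.coe_pow, h, SpecialLinearGroup.coe_one]
  have hscalar (r : F) : (x : Matrix (Fin 3) (Fin 3) F) ≠ r • 1 := by
    intro h
    refine hxc (Subgroup.mem_center_iff.mpr fun g => Subtype.ext ?_)
    simp [h]
  have hinj : Function.Injective fun i : Fin 3 => w ^ (i : ℕ) := fun i j hij =>
    Fin.ext (hw.pow_inj i.isLt j.isLt hij)
  obtain ⟨P, hP, hxP⟩ := exists_det_eq_one_mul_eq_mul_diagonal hinj fun i =>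
    exists_mulVec_eq_smul_of_pow_three_eq_one hx3 x.det_coe hscalar
      (by rw [← pow_mul, mul_comm, pow_mul, hw.pow_eq_one, one_pow])
  exact ⟨⟨P, hP⟩, hxP⟩


/-- If `q ≡ 1 (mod 3)`, any two noncentral elements of order 3 in `SL(3, F_q)` are
conjugate. -/
theorem SL3_noncentral_order_three_conj
    (F : Type*) [Field F] [Fintype F] (hq : Fintype.card F ≡ 1 [MOD 3])
    (x y : Matrix.SpecialLinearGroup (Fin 3) F)
    (hx : orderOf x = 3) (hy : orderOf y = 3)
    (hxc : x ∉ Subgroup.center (Matrix.SpecialLinearGroup (Fin 3) F))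
    (hyc : y ∉ Subgroup.center (Matrix.SpecialLinearGroup (Fin 3) F)) :
    IsConj x y := by
  obtain ⟨w, hw⟩ := FiniteField.exists_isPrimitiveRoot_three hq
  obtain ⟨P, hP⟩ := Matrix.SpecialLinearGroup.exists_mul_eq_mul_diagonal hw hx hxc
  obtain ⟨Q, hQ⟩ := Matrix.SpecialLinearGroup.exists_mul_eq_mul_diagonal hw hy hyc
  have conj_eq {R z : Matrix.SpecialLinearGroup (Fin 3) F}
      (h : (z : Matrix (Fin 3) (Fin 3) F) * R = R * diagonal fun i : Fin 3 => w ^ (i : ℕ)) :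
      ((R⁻¹ * z * R : Matrix.SpecialLinearGroup (Fin 3) F) : Matrix (Fin 3) (Fin 3) F)
        = diagonal fun i : Fin 3 => w ^ (i : ℕ) := by
    rw [mul_assoc, Matrix.SpecialLinearGroup.coe_mul, Matrix.SpecialLinearGroup.coe_mul, h,
      ← mul_assoc, ← Matrix.SpecialLinearGroup.coe_mul, inv_mul_cancel,
      Matrix.SpecialLinearGroup.coe_one, one_mul]
  have key : P⁻¹ * x * P = Q⁻¹ * y * Q := Subtype.ext ((conj_eq hP).trans (conj_eq hQ).symm)
  refine isConj_iff.mpr ⟨Q * P⁻¹, ?_⟩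
  calc Q * P⁻¹ * x * (Q * P⁻¹)⁻¹ = Q * (P⁻¹ * x * P) * Q⁻¹ := by group
    _ = y := by rw [key]; group
end
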